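/- Second compound-state lower bound (eq. (3.63), second case): I_c ≥ χ{p, τ_f}, where τ_f(α) := Σ_{ω : P_f(ω) > 0} P(ω|α)·ρ_f(ω) for each α with p_α > 0, and χ{p, τ_f} is the χ-quantity of the ensemble (p_α, τ_f(α))_{α : p_α > 0}, whose barycenter is η_f. -/

import Mathlib

open Matrix BigOperators
open scoped Kronecker ComplexOrder

noncomputable section

/-- A density matrix: positive semidefinite with unit trace. -/
def IsDensityMatrix {ι : Type*} [Fintype ι] (ρ : Matrix ι ι ℂ) : Prop :=
  ρ.PosSemidef ∧ ρ.trace = 1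

/-- von Neumann entropy (natural logarithm), via the eigenvalues;
junk value `0` if the matrix is not Hermitian. -/
noncomputable def vnEntropy {ι : Type*} [Fintype ι] [DecidableEq ι]
    (ρ : Matrix ι ι ℂ) : ℝ :=
  if h : ρ.IsHermitian then -∑ i, h.eigenvalues i * Real.log (h.eigenvalues i) else 0

/-- Quantum relative entropy `S(σ|τ)` (natural logarithm), computed in an orthonormal
eigenbasis of `τ`; junk value `0` if `σ` or `τ` is not Hermitian. -/
noncomputable def relEnt {ι : Type*} [Fintype ι] [DecidableEq ι]
    (σ τ : Matrix ι ι ℂ) : ℝ :=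
  if h : σ.IsHermitian ∧ τ.IsHermitian then
    (∑ i, h.1.eigenvalues i * Real.log (h.1.eigenvalues i))
      - ∑ j, (if 0 < h.2.eigenvalues j then
          Real.log (h.2.eigenvalues j) *
            ((star (fun i => h.2.eigenvectorBasis j i)) ⬝ᵥ
              σ.mulVec (fun i => h.2.eigenvectorBasis j i)).re
        else 0)
  else 0

/-- Holevo χ-quantity of an ensemble of states, relative to its barycenter. -/
noncomputable def holevoChi {ι B : Type*} [Fintype ι] [DecidableEq ι] [Fintype B]
    (q : B → ℝ) (τ : B → Matrix ι ι ℂ) : ℝ :=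
  ∑ β, if 0 < q β then q β * relEnt (τ β) (∑ γ, q γ • τ γ) else 0

/-- The action of an instrument in Kraus form: `I_ω(ρ) = ∑ k, V ω k * ρ * (V ω k)ᴴ`. -/
noncomputable def instAct {n m : ℕ} {Ω K : Type*} [Fintype K]
    (V : Ω → K → Matrix (Fin m) (Fin n) ℂ) (ω : Ω)
    (ρ : Matrix (Fin n) (Fin n) ℂ) : Matrix (Fin m) (Fin m) ℂ :=
  ∑ k, V ω k * ρ * (V ω k)ᴴ

/-- The POVM associated with an instrument in Kraus form: `E_ω = ∑ k, (V ω k)ᴴ * V ω k`. -/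
noncomputable def povm {n m : ℕ} {Ω K : Type*} [Fintype K]
    (V : Ω → K → Matrix (Fin m) (Fin n) ℂ) (ω : Ω) : Matrix (Fin n) (Fin n) ℂ :=
  ∑ k, (V ω k)ᴴ * V ω k

/-- Outcome probability `Tr(E_ω ρ)`. -/
noncomputable def probOut {n m : ℕ} {Ω K : Type*} [Fintype K]
    (V : Ω → K → Matrix (Fin m) (Fin n) ℂ) (ρ : Matrix (Fin n) (Fin n) ℂ) (ω : Ω) : ℝ :=
  ((povm V ω * ρ).trace).re

/-- The a posteriori state `π_ρ(ω) = I_ω(ρ)/Tr(I_ω(ρ))` (junk if the trace vanishes). -/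
noncomputable def post {n m : ℕ} {Ω K : Type*} [Fintype K]
    (V : Ω → K → Matrix (Fin m) (Fin n) ℂ) (ω : Ω)
    (ρ : Matrix (Fin n) (Fin n) ℂ) : Matrix (Fin m) (Fin m) ℂ :=
  (((instAct V ω ρ).trace.re)⁻¹ : ℝ) • instAct V ω ρ

/-- The classical (Shannon) input/output mutual information of the ensemble `(p, ρ)`
measured with the POVM of the instrument `V`. -/
noncomputable def Ic {n m : ℕ} {A Ω K : Type*} [Fintype A] [Fintype Ω] [Fintype K]
    (p : A → ℝ) (ρ : A → Matrix (Fin n) (Fin n) ℂ)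
    (V : Ω → K → Matrix (Fin m) (Fin n) ℂ) : ℝ :=
  ∑ α, ∑ ω,
    if 0 < p α * probOut V (ρ α) ω then
      p α * probOut V (ρ α) ω *
        Real.log ((p α * probOut V (ρ α) ω) /
          (p α * probOut V (∑ β, p β • ρ β) ω))
    else 0

/-- Quantum information gain of the instrument `V` at the state `ρ`. -/
noncomputable def infoGain {n m : ℕ} {Ω K : Type*} [Fintype Ω] [Fintype K]
    (V : Ω → K → Matrix (Fin m) (Fin n) ℂ) (ρ : Matrix (Fin n) (Fin n) ℂ) : ℝ :=
  vnEntropy ρ - ∑ ω, if 0 < (instAct V ω ρ).trace.re then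
    (instAct V ω ρ).trace.re * vnEntropy (post V ω ρ) else 0

theorem sum_mul_log_nonneg {ι : Type*} [Fintype ι] (w x : ι → ℝ) (hx : ∀ i, 0 ≤ x i)
    (hw : ∀ i, x i = 0 → w i = 0) (hsum : ∑ i, w i = 0)
    (h : ∀ t : ℝ, 0 < t → 0 ≤ ∑ i, w i * (x i / (1 + t * x i))) :
    0 ≤ ∑ i, w i * Real.log (x i) := by
  have hpos : ∀ t : ℝ, 0 ≤ t → ∀ i, 0 < 1 + t * x i := fun t ht i => by
    have := mul_nonneg ht (hx i); linarith
  have hder : ∀ t : ℝ, 0 ≤ t → HasDerivAt (fun t : ℝ => ∑ i, w i * Real.log (1 + t * x i))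
      (∑ i, w i * (x i / (1 + t * x i))) t := by
    intro t ht
    refine HasDerivAt.fun_sum fun i _ => HasDerivAt.const_mul _ ?_
    refine HasDerivAt.log ?_ (hpos t ht i).ne'
    simpa using ((hasDerivAt_id t).mul_const (x i)).const_add 1
  have hmono : MonotoneOn (fun t : ℝ => ∑ i, w i * Real.log (1 + t * x i)) (Set.Ici 0) := by
    refine monotoneOn_of_deriv_nonneg (convex_Ici 0)
      (fun t ht => (hder t ht).continuousAt.continuousWithinAt) ?_ ?_
    · intro t ht
      rw [interior_Ici] at ht
      exact (hder t (le_of_lt ht)).differentiableAt.differentiableWithinAt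
    · intro t ht
      rw [interior_Ici] at ht
      rw [(hder t (le_of_lt ht)).deriv]
      exact h t ht
  have hshift : ∀ s : ℝ, 0 < s → 0 ≤ ∑ i, w i * Real.log (x i + s) := by
    intro s hs
    have h0 := hmono Set.self_mem_Ici (Set.mem_Ici.2 (inv_pos.2 hs).le) (inv_pos.2 hs).le
    have hlog : ∀ i, w i * Real.log (1 + s⁻¹ * x i)
        = w i * Real.log (x i + s) - w i * Real.log s := fun i => by
      have : 1 + s⁻¹ * x i = (x i + s) / s := by field_simp; ring
      rw [this, Real.log_div (by have := hx i; positivity) hs.ne']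
      ring
    simp only [hlog, Finset.sum_sub_distrib, ← Finset.sum_mul, hsum] at h0
    simpa using h0
  have hlim : Filter.Tendsto (fun s : ℝ => ∑ i, w i * Real.log (x i + s))
      (nhdsWithin 0 (Set.Ioi 0)) (nhds (∑ i, w i * Real.log (x i))) := by
    refine tendsto_finsetSum _ fun i _ => ?_
    rcases (hx i).eq_or_lt with hi | hi
    · simp [hw i hi.symm]
    · have hc : ContinuousAt (fun s : ℝ => w i * Real.log (x i + s)) 0 := by
        refine continuousAt_const.mul (ContinuousAt.log (by fun_prop) (by simpa using hi.ne'))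
      simpa using hc.tendsto.mono_left nhdsWithin_le_nhds
  exact ge_of_tendsto hlim (Filter.eventually_of_mem self_mem_nhdsWithin hshift)

theorem sq_norm_trace_mul_le {ι : Type*} [Fintype ι] [DecidableEq ι] {σ : Matrix ι ι ℂ}
    (hσ : IsDensityMatrix σ) (Y : Matrix ι ι ℂ) :
    ‖(Y * σ).trace‖ ^ 2 ≤ (Y * σ * Yᴴ).trace.re := by
  set y : ℂ := (Y * σ).trace with hy
  have hy' : (σ * Yᴴ).trace = star y := by
    rw [hy, ← trace_conjTranspose, conjTranspose_mul, hσ.1.isHermitian.eq]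
  have h := (hσ.1.mul_mul_conjTranspose_same (Y - y • 1)).trace_nonneg
  have hexp : ((Y - y • 1) * σ * (Y - y • 1)ᴴ).trace = (Y * σ * Yᴴ).trace - y * star y := by
    simp only [conjTranspose_sub, conjTranspose_smul, conjTranspose_one, sub_mul, mul_sub,
      trace_sub, smul_mul_assoc, mul_smul_comm, trace_smul, one_mul, mul_one, hy', ← hy, hσ.2,
      smul_eq_mul]
    ring
  rw [hexp] at h
  have h2 := (Complex.le_def.1 h).1
  rw [Complex.star_def, Complex.mul_conj, Complex.normSq_eq_norm_sq, Complex.sub_re,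
    Complex.ofReal_re, Complex.zero_re] at h2
  linarith

theorem sq_norm_trace_mul_le' {ι : Type*} [Fintype ι] [DecidableEq ι] {σ : Matrix ι ι ℂ}
    (hσ : IsDensityMatrix σ) (Y : Matrix ι ι ℂ) :
    ‖(Y * σ).trace‖ ^ 2 ≤ (Yᴴ * σ * Y).trace.re := by
  have h := sq_norm_trace_mul_le hσ Yᴴ
  have htr : (Yᴴ * σ).trace = star (Y * σ).trace := by
    rw [trace_mul_comm Y, ← trace_conjTranspose, conjTranspose_mul, hσ.1.isHermitian.eq]
  rwa [conjTranspose_conjTranspose, htr, norm_star] at h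

/-- The concave quadratic functional of `Y` whose supremum is the quasi-entropy of `(τ, η)`
for the function `x ↦ x ^ 2 / (1 + t * x)`. -/
def quasiEntForm {ι : Type*} [Fintype ι] (t : ℝ) (Y τ η : Matrix ι ι ℂ) : ℝ :=
  2 * (Y * τ).trace.re - (Y * η * Yᴴ).trace.re - t * (Yᴴ * τ * Y).trace.re

theorem quasiEntForm_sum_le {ι Ω : Type*} [Fintype ι] [DecidableEq ι] [Fintype Ω]
    (a b : Ω → ℝ) (ha : ∀ ω, 0 ≤ a ω) (hb : ∀ ω, 0 ≤ b ω) (hab : ∀ ω, b ω = 0 → a ω = 0)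
    (σ : Ω → Matrix ι ι ℂ) (hσ : ∀ ω, 0 < b ω → IsDensityMatrix (σ ω)) {t : ℝ} (ht : 0 < t)
    (Y : Matrix ι ι ℂ) :
    quasiEntForm t Y (∑ ω, a ω • σ ω) (∑ ω, b ω • σ ω)
      ≤ ∑ ω, a ω * ((a ω / b ω) / (1 + t * (a ω / b ω))) := by
  have hlin : quasiEntForm t Y (∑ ω, a ω • σ ω) (∑ ω, b ω • σ ω)
      = ∑ ω, (2 * a ω * (Y * σ ω).trace.re - b ω * (Y * σ ω * Yᴴ).trace.re
          - t * a ω * (Yᴴ * σ ω * Y).trace.re) := by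
    simp only [quasiEntForm, Finset.mul_sum, Finset.sum_mul, trace_sum, Complex.re_sum,
      mul_smul_comm, smul_mul_assoc, trace_smul, Complex.real_smul, Complex.re_ofReal_mul,
      ← Finset.sum_sub_distrib]
    exact Finset.sum_congr rfl fun _ _ => by ring
  rw [hlin]
  refine Finset.sum_le_sum fun ω _ => ?_
  rcases (hb ω).eq_or_lt with h0 | h0
  · simp [← h0, hab ω h0.symm]
  · have h1 := mul_le_mul_of_nonneg_left (sq_norm_trace_mul_le (hσ ω h0) Y) h0.le
    have h2 := mul_le_mul_of_nonneg_left (sq_norm_trace_mul_le' (hσ ω h0) Y)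
      (mul_nonneg ht.le (ha ω))
    have h3 := mul_le_mul_of_nonneg_left (Complex.re_le_norm (Y * σ ω).trace) (ha ω)
    have hpos : 0 < b ω + t * a ω := by have := mul_nonneg ht.le (ha ω); linarith
    have hrhs : a ω * ((a ω / b ω) / (1 + t * (a ω / b ω))) = a ω ^ 2 / (b ω + t * a ω) := by
      have : 1 + t * (a ω / b ω) = (b ω + t * a ω) / b ω := by field_simp
      rw [this]
      field_simp
    rw [hrhs, le_div_iff₀ hpos]
    set r := ‖(Y * σ ω).trace‖
    have h4 : 2 * a ω * (Y * σ ω).trace.re - b ω * (Y * σ ω * Yᴴ).trace.re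
        - t * a ω * (Yᴴ * σ ω * Y).trace.re ≤ 2 * a ω * r - (b ω + t * a ω) * r ^ 2 := by
      linarith
    refine (mul_le_mul_of_nonneg_right h4 hpos.le).trans ?_
    nlinarith [sq_nonneg (a ω - (b ω + t * a ω) * r)]

/-- Squared overlaps of the eigenbases of two Hermitian matrices. -/
def eigenOverlap {ι : Type*} [Fintype ι] [DecidableEq ι] {τ η : Matrix ι ι ℂ}
    (hτ : τ.IsHermitian) (hη : η.IsHermitian) (k j : ι) : ℝ :=
  ‖((hτ.eigenvectorUnitary : Matrix ι ι ℂ)ᴴ * (hη.eigenvectorUnitary : Matrix ι ι ℂ)) k j‖ ^ 2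

theorem eigenOverlap_nonneg {ι : Type*} [Fintype ι] [DecidableEq ι] {τ η : Matrix ι ι ℂ}
    (hτ : τ.IsHermitian) (hη : η.IsHermitian) (k j : ι) : 0 ≤ eigenOverlap hτ hη k j :=
  sq_nonneg _

theorem Matrix.IsHermitian.eq_mul_diagonal_mul {ι : Type*} [Fintype ι] [DecidableEq ι]
    {τ : Matrix ι ι ℂ} (hτ : τ.IsHermitian) :
    τ = (hτ.eigenvectorUnitary : Matrix ι ι ℂ) * diagonal (fun k => (hτ.eigenvalues k : ℂ))
      * (hτ.eigenvectorUnitary : Matrix ι ι ℂ)ᴴ :=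
  hτ.spectral_theorem

theorem Matrix.IsHermitian.conjTranspose_mul_eigenvectorUnitary {ι : Type*} [Fintype ι]
    [DecidableEq ι] {τ : Matrix ι ι ℂ} (hτ : τ.IsHermitian) :
    (hτ.eigenvectorUnitary : Matrix ι ι ℂ)ᴴ * (hτ.eigenvectorUnitary : Matrix ι ι ℂ) = 1 :=
  Unitary.coe_star_mul_self _

theorem Matrix.IsHermitian.mul_conjTranspose_eigenvectorUnitary {ι : Type*} [Fintype ι]
    [DecidableEq ι] {τ : Matrix ι ι ℂ} (hτ : τ.IsHermitian) :
    (hτ.eigenvectorUnitary : Matrix ι ι ℂ) * (hτ.eigenvectorUnitary : Matrix ι ι ℂ)ᴴ = 1 :=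
  Unitary.coe_mul_star_self _

theorem mul_conjTranspose_apply_self {ι : Type*} [Fintype ι] (M : Matrix ι ι ℂ) (k : ι) :
    (M * Mᴴ) k k = ((∑ j, ‖M k j‖ ^ 2 : ℝ) : ℂ) := by
  simp [mul_apply, Complex.mul_conj, Complex.normSq_eq_norm_sq]

theorem sum_eigenOverlap {ι : Type*} [Fintype ι] [DecidableEq ι] {τ η : Matrix ι ι ℂ}
    (hτ : τ.IsHermitian) (hη : η.IsHermitian) (k : ι) : ∑ j, eigenOverlap hτ hη k j = 1 := by
  have h := mul_conjTranspose_apply_self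
    ((hτ.eigenvectorUnitary : Matrix ι ι ℂ)ᴴ * (hη.eigenvectorUnitary : Matrix ι ι ℂ)) k
  rw [conjTranspose_mul, conjTranspose_conjTranspose, Matrix.mul_assoc,
    ← Matrix.mul_assoc _ _ (hτ.eigenvectorUnitary : Matrix ι ι ℂ),
    hη.mul_conjTranspose_eigenvectorUnitary, Matrix.one_mul,
    hτ.conjTranspose_mul_eigenvectorUnitary, one_apply_eq] at h
  exact_mod_cast h.symm

theorem re_star_dotProduct_mulVec_eigenvectorBasis {ι : Type*} [Fintype ι] [DecidableEq ι]
    {τ η : Matrix ι ι ℂ} (hτ : τ.IsHermitian) (hη : η.IsHermitian) (j : ι) :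
    ((star (fun i => hη.eigenvectorBasis j i)) ⬝ᵥ
      τ.mulVec (fun i => hη.eigenvectorBasis j i)).re
      = ∑ k, hτ.eigenvalues k * eigenOverlap hτ hη k j := by
  set U := (hτ.eigenvectorUnitary : Matrix ι ι ℂ) with hU
  set W := (hη.eigenvectorUnitary : Matrix ι ι ℂ) with hW
  have h1 : (star (fun i => hη.eigenvectorBasis j i)) ⬝ᵥ
      τ.mulVec (fun i => hη.eigenvectorBasis j i) = (Wᴴ * (τ * W)) j j := by
    simp [mul_apply, dotProduct, mulVec, hW, conjTranspose_apply]
  have h2 : Wᴴ * (τ * W)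
      = (Uᴴ * W)ᴴ * (diagonal (fun k => (hτ.eigenvalues k : ℂ)) * (Uᴴ * W)) := by
    conv_lhs => rw [hτ.eq_mul_diagonal_mul]
    simp only [conjTranspose_mul, conjTranspose_conjTranspose, Matrix.mul_assoc, hU]
  rw [h1, h2, mul_apply, Complex.re_sum]
  refine Finset.sum_congr rfl fun k _ => ?_
  rw [diagonal_mul, conjTranspose_apply, eigenOverlap, ← Complex.normSq_eq_norm_sq,
    Complex.star_def, mul_left_comm, ← Complex.normSq_eq_conj_mul_self, ← Complex.ofReal_mul,
    Complex.ofReal_re]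

theorem relEnt_eq_sum_eigenOverlap {ι : Type*} [Fintype ι] [DecidableEq ι]
    {τ η : Matrix ι ι ℂ} (hτ : τ.PosSemidef) (hη : η.PosSemidef)
    (hker : ∀ k j, hη.isHermitian.eigenvalues j = 0 →
      hτ.isHermitian.eigenvalues k * eigenOverlap hτ.isHermitian hη.isHermitian k j = 0) :
    relEnt τ η = ∑ k, ∑ j,
      hτ.isHermitian.eigenvalues k * eigenOverlap hτ.isHermitian hη.isHermitian k j *
        Real.log (hτ.isHermitian.eigenvalues k / hη.isHermitian.eigenvalues j) := by
  rw [relEnt, dif_pos ⟨hτ.isHermitian, hη.isHermitian⟩]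
  have h1 : ∀ j, (if 0 < hη.isHermitian.eigenvalues j then
      Real.log (hη.isHermitian.eigenvalues j) *
        ((star (fun i => hη.isHermitian.eigenvectorBasis j i)) ⬝ᵥ
          τ.mulVec (fun i => hη.isHermitian.eigenvectorBasis j i)).re else 0)
      = ∑ k, hτ.isHermitian.eigenvalues k * eigenOverlap hτ.isHermitian hη.isHermitian k j *
        Real.log (hη.isHermitian.eigenvalues j) := by
    intro j
    rw [re_star_dotProduct_mulVec_eigenvectorBasis hτ.isHermitian, ← Finset.sum_mul]
    rcases (hη.eigenvalues_nonneg j).eq_or_lt with h | h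
    · simp [← h]
    · rw [if_pos h, mul_comm]
  have h2 : ∀ k, hτ.isHermitian.eigenvalues k * Real.log (hτ.isHermitian.eigenvalues k)
      = ∑ j, hτ.isHermitian.eigenvalues k * eigenOverlap hτ.isHermitian hη.isHermitian k j *
        Real.log (hτ.isHermitian.eigenvalues k) := by
    intro k
    rw [← Finset.sum_mul, ← Finset.mul_sum, sum_eigenOverlap, mul_one]
  simp only [h1, h2]
  rw [Finset.sum_comm (f := fun j k => hτ.isHermitian.eigenvalues k *
    eigenOverlap hτ.isHermitian hη.isHermitian k j * Real.log (hη.isHermitian.eigenvalues j)),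
    ← Finset.sum_sub_distrib]
  refine Finset.sum_congr rfl fun k _ => ?_
  rw [← Finset.sum_sub_distrib]
  refine Finset.sum_congr rfl fun j _ => ?_
  by_cases hk : hτ.isHermitian.eigenvalues k = 0
  · simp [hk]
  by_cases hj : hη.isHermitian.eigenvalues j = 0
  · simp [hker k j hj]
  rw [Real.log_div hk hj]
  ring

theorem exists_quasiEntForm_eq {ι : Type*} [Fintype ι] [DecidableEq ι] {τ η : Matrix ι ι ℂ}
    (hτ : τ.IsHermitian) (hη : η.IsHermitian) (t : ℝ) (y : ι → ι → ℝ) :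
    ∃ Y, quasiEntForm t Y τ η = ∑ k, ∑ j, eigenOverlap hτ hη k j *
      (2 * hτ.eigenvalues k * y k j
        - (hη.eigenvalues j + t * hτ.eigenvalues k) * y k j ^ 2) := by
  set U := (hτ.eigenvectorUnitary : Matrix ι ι ℂ) with hU
  set W := (hη.eigenvectorUnitary : Matrix ι ι ℂ) with hW
  have hUU : Uᴴ * U = 1 := hτ.conjTranspose_mul_eigenvectorUnitary
  have hWW : Wᴴ * W = 1 := hη.conjTranspose_mul_eigenvectorUnitary
  have hUU' : ∀ X, Uᴴ * (U * X) = X := fun X => by rw [← Matrix.mul_assoc, hUU, Matrix.one_mul]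
  have hWW' : ∀ X, Wᴴ * (W * X) = X := fun X => by rw [← Matrix.mul_assoc, hWW, Matrix.one_mul]
  set D := diagonal (fun k => (hτ.eigenvalues k : ℂ))
  set E := diagonal (fun k => (hη.eigenvalues k : ℂ))
  have hτD : τ = U * D * Uᴴ := hτ.eq_mul_diagonal_mul
  have hηE : η = W * E * Wᴴ := hη.eq_mul_diagonal_mul
  set M := Uᴴ * W with hM
  let N : Matrix ι ι ℂ := Matrix.of fun k j => (y k j : ℂ) * M k j
  have hN : ∀ k j, N k j = (y k j : ℂ) * M k j := fun _ _ => rfl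
  have hov : ∀ k j, eigenOverlap hτ hη k j = ‖M k j‖ ^ 2 := fun _ _ => rfl
  refine ⟨U * N * Wᴴ, ?_⟩
  have e1 : (U * N * Wᴴ * τ).trace = (N * Mᴴ * D).trace := by
    rw [hτD, hM, conjTranspose_mul, conjTranspose_conjTranspose]
    simp only [Matrix.mul_assoc]
    rw [trace_mul_comm U]
    simp only [Matrix.mul_assoc, hUU, Matrix.mul_one]
  have e2 : (U * N * Wᴴ * η * (U * N * Wᴴ)ᴴ).trace = (N * E * Nᴴ).trace := by
    rw [hηE]
    simp only [conjTranspose_mul, conjTranspose_conjTranspose, Matrix.mul_assoc, hWW']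
    rw [trace_mul_comm U]
    simp only [Matrix.mul_assoc, hUU, Matrix.mul_one]
  have e3 : ((U * N * Wᴴ)ᴴ * τ * (U * N * Wᴴ)).trace = (Nᴴ * D * N).trace := by
    rw [hτD]
    simp only [conjTranspose_mul, conjTranspose_conjTranspose, Matrix.mul_assoc, hUU']
    rw [trace_mul_comm W]
    simp only [Matrix.mul_assoc, hWW, Matrix.mul_one]
  have f1 : (N * Mᴴ * D).trace.re = ∑ k, ∑ j, ‖M k j‖ ^ 2 * (hτ.eigenvalues k * y k j) := by
    simp only [trace, diag_apply, D, mul_diagonal]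
    simp only [mul_apply, conjTranspose_apply, hN, Complex.star_def, mul_assoc, Complex.mul_conj,
      Complex.normSq_eq_norm_sq, Finset.sum_mul, Complex.re_sum]
    refine Finset.sum_congr rfl fun k _ => Finset.sum_congr rfl fun j _ => ?_
    norm_cast
    ring
  have f2 : (N * E * Nᴴ).trace.re
      = ∑ k, ∑ j, ‖M k j‖ ^ 2 * (hη.eigenvalues j * y k j ^ 2) := by
    simp only [trace, diag_apply, E, mul_apply (N := Nᴴ), mul_diagonal, conjTranspose_apply,
      Complex.re_sum]
    refine Finset.sum_congr rfl fun k _ => Finset.sum_congr rfl fun j _ => ?_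
    rw [mul_right_comm, Complex.star_def, Complex.mul_conj, Complex.normSq_eq_norm_sq, hN,
      norm_mul, Complex.norm_real, mul_pow, Real.norm_eq_abs, sq_abs]
    norm_cast
    ring
  have f3 : (Nᴴ * D * N).trace.re
      = ∑ k, ∑ j, ‖M k j‖ ^ 2 * (hτ.eigenvalues k * y k j ^ 2) := by
    simp only [trace, diag_apply, D, mul_apply (N := N), mul_diagonal, conjTranspose_apply,
      Complex.re_sum]
    rw [Finset.sum_comm]
    refine Finset.sum_congr rfl fun k _ => Finset.sum_congr rfl fun j _ => ?_
    rw [mul_right_comm, mul_comm (star _), Complex.star_def, Complex.mul_conj,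
      Complex.normSq_eq_norm_sq, hN,
      norm_mul, Complex.norm_real, mul_pow, Real.norm_eq_abs, sq_abs]
    norm_cast
    ring
  rw [quasiEntForm, e1, e2, e3, f1, f2, f3]
  simp only [Finset.mul_sum, ← Finset.sum_sub_distrib, hov]
  exact Finset.sum_congr rfl fun k _ => Finset.sum_congr rfl fun j _ => by ring

/-- Monotonicity of the relative entropy under the preparation channel `ω ↦ σ ω`. -/
theorem relEnt_sum_smul_le {ι Ω : Type*} [Fintype ι] [DecidableEq ι] [Fintype Ω]
    (a b : Ω → ℝ) (ha : ∀ ω, 0 ≤ a ω) (hb : ∀ ω, 0 ≤ b ω) (hab : ∀ ω, b ω = 0 → a ω = 0)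
    (σ : Ω → Matrix ι ι ℂ) (hσ : ∀ ω, (σ ω).PosSemidef)
    (hσ1 : ∀ ω, 0 < b ω → (σ ω).trace = 1) :
    relEnt (∑ ω, a ω • σ ω) (∑ ω, b ω • σ ω) ≤ ∑ ω, a ω * Real.log (a ω / b ω) := by
  set τ := ∑ ω, a ω • σ ω with hτdef
  set η := ∑ ω, b ω • σ ω with hηdef
  have hτ : τ.PosSemidef := posSemidef_sum _ fun ω _ => (hσ ω).smul (ha ω)
  have hη : η.PosSemidef := posSemidef_sum _ fun ω _ => (hσ ω).smul (hb ω)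
  have hquad : ∀ (c : Ω → ℝ) (x : ι → ℂ), (star x ⬝ᵥ (∑ ω, c ω • σ ω).mulVec x).re
      = ∑ ω, c ω * (star x ⬝ᵥ (σ ω).mulVec x).re := fun c x => by
    simp [sum_mulVec, dotProduct_sum, smul_mulVec, dotProduct_smul]
  have hnn : ∀ k j, 0 ≤ hτ.isHermitian.eigenvalues k *
      eigenOverlap hτ.isHermitian hη.isHermitian k j := fun k j =>
    mul_nonneg (hτ.eigenvalues_nonneg k) (eigenOverlap_nonneg ..)
  have hker : ∀ k j, hη.isHermitian.eigenvalues j = 0 → hτ.isHermitian.eigenvalues k *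
      eigenOverlap hτ.isHermitian hη.isHermitian k j = 0 := by
    intro k j hj
    set x : ι → ℂ := fun i => hη.isHermitian.eigenvectorBasis j i with hx
    have hη0 : (star x ⬝ᵥ η.mulVec x).re = 0 := by
      have h0 : η.mulVec x = hη.isHermitian.eigenvalues j • x :=
        hη.isHermitian.mulVec_eigenvectorBasis j
      rw [h0, hj]
      simp
    have hσx : ∀ ω, 0 ≤ (star x ⬝ᵥ (σ ω).mulVec x).re := fun ω => (hσ ω).re_dotProduct_nonneg x
    rw [hηdef, hquad, Finset.sum_eq_zero_iff_of_nonneg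
      fun ω _ => mul_nonneg (hb ω) (hσx ω)] at hη0
    have hτ0 : (star x ⬝ᵥ τ.mulVec x).re = 0 := by
      rw [hτdef, hquad]
      refine Finset.sum_eq_zero fun ω hω => ?_
      rcases mul_eq_zero.1 (hη0 ω hω) with h | h
      · rw [hab ω h, zero_mul]
      · rw [h, mul_zero]
    rw [re_star_dotProduct_mulVec_eigenvectorBasis hτ.isHermitian,
      Finset.sum_eq_zero_iff_of_nonneg fun k _ => hnn k j] at hτ0
    exact hτ0 k (Finset.mem_univ k)
  have hsum : ∑ k, ∑ j, hτ.isHermitian.eigenvalues k *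
      eigenOverlap hτ.isHermitian hη.isHermitian k j = ∑ ω, a ω := by
    simp only [← Finset.mul_sum, sum_eigenOverlap, mul_one]
    have h1 := hτ.isHermitian.trace_eq_sum_eigenvalues
    have h2 : τ.trace = ((∑ ω, a ω : ℝ) : ℂ) := by
      rw [hτdef, trace_sum, Complex.ofReal_sum]
      refine Finset.sum_congr rfl fun ω _ => ?_
      rcases (hb ω).eq_or_lt with h | h
      · simp [hab ω h.symm]
      · simp [trace_smul, hσ1 ω h]
    rw [h2] at h1
    have h3 := congrArg Complex.re h1
    simpa using h3.symm
  have key := sum_mul_log_nonneg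
    (Sum.elim a fun kj : ι × ι => -(hτ.isHermitian.eigenvalues kj.1 *
      eigenOverlap hτ.isHermitian hη.isHermitian kj.1 kj.2))
    (Sum.elim (fun ω => a ω / b ω) fun kj : ι × ι =>
      hτ.isHermitian.eigenvalues kj.1 / hη.isHermitian.eigenvalues kj.2) ?_ ?_ ?_ ?_
  · rw [relEnt_eq_sum_eigenOverlap hτ hη hker]
    simpa [Fintype.sum_sum_type, Fintype.sum_prod_type] using key
  · rintro (ω | ⟨k, j⟩)
    · exact div_nonneg (ha ω) (hb ω)
    · exact div_nonneg (hτ.eigenvalues_nonneg k) (hη.eigenvalues_nonneg j)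
  · rintro (ω | ⟨k, j⟩) h
    · rcases div_eq_zero_iff.1 h with h | h
      · exact h
      · exact hab ω h
    · rcases div_eq_zero_iff.1 h with h | h
      · exact neg_eq_zero.2 (mul_eq_zero_of_left h _)
      · exact neg_eq_zero.2 (hker k j h)
  · simp [Fintype.sum_sum_type, Fintype.sum_prod_type, hsum]
  · intro t ht
    obtain ⟨Y, hY⟩ := exists_quasiEntForm_eq hτ.isHermitian hη.isHermitian t
      fun k j => hτ.isHermitian.eigenvalues k /
        (hη.isHermitian.eigenvalues j + t * hτ.isHermitian.eigenvalues k)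
    have hle := quasiEntForm_sum_le a b ha hb hab σ (fun ω h => ⟨hσ ω, hσ1 ω h⟩) ht Y
    rw [← hτdef, ← hηdef, hY] at hle
    simp only [Fintype.sum_sum_type, Fintype.sum_prod_type, Sum.elim_inl, Sum.elim_inr, neg_mul,
      Finset.sum_neg_distrib, ← sub_eq_add_neg, sub_nonneg]
    refine le_of_eq_of_le ?_ hle
    refine Finset.sum_congr rfl fun k _ => Finset.sum_congr rfl fun j _ => ?_
    have hker' := hker k j
    have hk := hτ.eigenvalues_nonneg k
    have hj := hη.eigenvalues_nonneg j
    generalize hτ.isHermitian.eigenvalues k = x at *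
    generalize hη.isHermitian.eigenvalues j = s at *
    generalize eigenOverlap hτ.isHermitian hη.isHermitian k j = c at *
    rcases hj.eq_or_lt with h | h
    · rcases mul_eq_zero.1 (hker' h.symm) with h' | h' <;> simp [h']
    · have hpos : 0 < s + t * x := by have := mul_nonneg ht.le hk; linarith
      have : 1 + t * (x / s) = (s + t * x) / s := by field_simp
      rw [this]
      field_simp
      ring

theorem trace_instAct {n m : ℕ} {Ω K : Type*} [Fintype K]
    (V : Ω → K → Matrix (Fin m) (Fin n) ℂ) (ω : Ω) (ρ : Matrix (Fin n) (Fin n) ℂ) :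
    (instAct V ω ρ).trace = (povm V ω * ρ).trace := by
  simp only [instAct, povm, trace_sum, Finset.sum_mul]
  exact Finset.sum_congr rfl fun k _ => trace_mul_cycle _ _ _

theorem instAct_posSemidef {n m : ℕ} {Ω K : Type*} [Fintype K]
    (V : Ω → K → Matrix (Fin m) (Fin n) ℂ) (ω : Ω) {ρ : Matrix (Fin n) (Fin n) ℂ}
    (hρ : ρ.PosSemidef) : (instAct V ω ρ).PosSemidef :=
  posSemidef_sum _ fun k _ => hρ.mul_mul_conjTranspose_same (V ω k)

theorem ofReal_probOut {n m : ℕ} {Ω K : Type*} [Fintype K]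
    (V : Ω → K → Matrix (Fin m) (Fin n) ℂ) (ω : Ω) {ρ : Matrix (Fin n) (Fin n) ℂ}
    (hρ : ρ.PosSemidef) : (probOut V ρ ω : ℂ) = (instAct V ω ρ).trace := by
  rw [probOut, ← trace_instAct]
  exact Complex.ext rfl
    (Complex.nonneg_iff.1 (instAct_posSemidef V ω hρ).trace_nonneg).2

theorem probOut_nonneg {n m : ℕ} {Ω K : Type*} [Fintype K]
    (V : Ω → K → Matrix (Fin m) (Fin n) ℂ) (ω : Ω) {ρ : Matrix (Fin n) (Fin n) ℂ}
    (hρ : ρ.PosSemidef) : 0 ≤ probOut V ρ ω := by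
  rw [probOut, ← trace_instAct]
  exact (Complex.nonneg_iff.1 (instAct_posSemidef V ω hρ).trace_nonneg).1

theorem probOut_sum_smul {n m : ℕ} {A Ω K : Type*} [Fintype A] [Fintype K]
    (V : Ω → K → Matrix (Fin m) (Fin n) ℂ) (ω : Ω) (p : A → ℝ)
    (ρ : A → Matrix (Fin n) (Fin n) ℂ) :
    probOut V (∑ α, p α • ρ α) ω = ∑ α, p α * probOut V (ρ α) ω := by
  simp [probOut, Finset.mul_sum, trace_sum, trace_smul]

theorem post_posSemidef {n m : ℕ} {Ω K : Type*} [Fintype K]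
    (V : Ω → K → Matrix (Fin m) (Fin n) ℂ) (ω : Ω) {ρ : Matrix (Fin n) (Fin n) ℂ}
    (hρ : ρ.PosSemidef) : (post V ω ρ).PosSemidef :=
  (instAct_posSemidef V ω hρ).smul (inv_nonneg.2
    (Complex.nonneg_iff.1 (instAct_posSemidef V ω hρ).trace_nonneg).1)

theorem probOut_smul_post {n m : ℕ} {Ω K : Type*} [Fintype K]
    (V : Ω → K → Matrix (Fin m) (Fin n) ℂ) (ω : Ω) {ρ : Matrix (Fin n) (Fin n) ℂ}
    (hρ : ρ.PosSemidef) : probOut V ρ ω • post V ω ρ = instAct V ω ρ := by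
  by_cases h : probOut V ρ ω = 0
  · have h0 : instAct V ω ρ = 0 := by
      rw [← (instAct_posSemidef V ω hρ).trace_eq_zero_iff, ← ofReal_probOut V ω hρ, h,
        Complex.ofReal_zero]
    rw [h, h0, zero_smul]
  · rw [post, trace_instAct, ← probOut, smul_smul, mul_inv_cancel₀ h, one_smul]

theorem trace_post {n m : ℕ} {Ω K : Type*} [Fintype K]
    (V : Ω → K → Matrix (Fin m) (Fin n) ℂ) (ω : Ω) {ρ : Matrix (Fin n) (Fin n) ℂ}
    (hρ : ρ.PosSemidef) (h : 0 < probOut V ρ ω) : (post V ω ρ).trace = 1 := by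
  rw [post, trace_smul, ← ofReal_probOut V ω hρ, Complex.ofReal_re, Complex.real_smul,
    ← Complex.ofReal_mul, inv_mul_cancel₀ h.ne', Complex.ofReal_one]

theorem second_compound_lower_bound {A Ω K : Type*} [Fintype A] [Fintype Ω] [Fintype K]
    [Nonempty A] [Nonempty Ω] [Nonempty K] {n m : ℕ} (hn : 1 ≤ n) (hm : 1 ≤ m)
    (p : A → ℝ) (hp0 : ∀ α, 0 ≤ p α) (hp1 : ∑ α, p α = 1)
    (ρ : A → Matrix (Fin n) (Fin n) ℂ) (hρ : ∀ α, IsDensityMatrix (ρ α))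
    (V : Ω → K → Matrix (Fin m) (Fin n) ℂ)
    (hV : ∑ ω, ∑ k, (V ω k)ᴴ * V ω k = 1)
    (η : Matrix (Fin n) (Fin n) ℂ) (hη : η = ∑ α, p α • ρ α)
    (Pf : Ω → ℝ) (hPf : ∀ ω, Pf ω = probOut V η ω)
    (ηf : Matrix (Fin m) (Fin m) ℂ) (hηf : ηf = ∑ ω, instAct V ω η)
    (τf : A → Matrix (Fin m) (Fin m) ℂ)
    (hτf : ∀ α, 0 < p α → τf α =
      ∑ ω, if 0 < Pf ω then probOut V (ρ α) ω • post V ω η else 0) :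
    (∑ α, p α • τf α = ηf) ∧
    Ic p ρ V ≥ holevoChi p τf := by
  subst hη hηf
  set η := ∑ α, p α • ρ α with hη
  have hηpos : η.PosSemidef := posSemidef_sum _ fun α _ => (hρ α).1.smul (hp0 α)
  have hPf0 : ∀ ω, 0 ≤ Pf ω := fun ω => hPf ω ▸ probOut_nonneg V ω hηpos
  have hP0 : ∀ α ω, 0 ≤ probOut V (ρ α) ω := fun α ω => probOut_nonneg V ω (hρ α).1
  have hPfsum : ∀ ω, Pf ω = ∑ α, p α * probOut V (ρ α) ω := fun ω => by
    rw [hPf, hη, probOut_sum_smul]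
  have hac : ∀ α, 0 < p α → ∀ ω, Pf ω = 0 → probOut V (ρ α) ω = 0 := by
    intro α hα ω h
    rw [hPfsum, Finset.sum_eq_zero_iff_of_nonneg
      fun α _ => mul_nonneg (hp0 α) (hP0 α ω)] at h
    exact (mul_eq_zero.1 (h α (Finset.mem_univ α))).resolve_left hα.ne'
  have hτ : ∀ α, 0 < p α → τf α = ∑ ω, probOut V (ρ α) ω • post V ω η := by
    intro α hα
    rw [hτf α hα]
    refine Finset.sum_congr rfl fun ω _ => ?_
    split_ifs with h
    · rfl
    · rw [hac α hα ω (le_antisymm (not_lt.1 h) (hPf0 ω)), zero_smul]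
  have hbary : ∑ α, p α • τf α = ∑ ω, Pf ω • post V ω η := by
    have h1 : ∀ α, p α • τf α = ∑ ω, (p α * probOut V (ρ α) ω) • post V ω η := by
      intro α
      rcases (hp0 α).eq_or_lt with h | h
      · simp [← h]
      · rw [hτ α h, Finset.smul_sum]
        simp only [smul_smul]
    simp only [h1, hPfsum, Finset.sum_smul]
    exact Finset.sum_comm
  refine ⟨?_, ?_⟩
  · rw [hbary]
    exact Finset.sum_congr rfl fun ω _ => by rw [hPf, probOut_smul_post V ω hηpos]
  · rw [ge_iff_le, holevoChi, Ic, hbary, ← hη]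
    refine Finset.sum_le_sum fun α _ => ?_
    split_ifs with hα
    · rw [hτ α hα]
      refine (mul_le_mul_of_nonneg_left (relEnt_sum_smul_le (probOut V (ρ α)) Pf (hP0 α) hPf0
        (hac α hα) (fun ω => post V ω η) (fun ω => post_posSemidef V ω hηpos)
        fun ω h => trace_post V ω hηpos (hPf ω ▸ h)) hα.le).trans_eq ?_
      rw [Finset.mul_sum]
      refine Finset.sum_congr rfl fun ω _ => ?_
      rcases (hP0 α ω).eq_or_lt with h | h
      · simp [← h]
      · rw [if_pos (mul_pos hα h), ← hPf, mul_div_mul_left _ _ hα.ne', mul_assoc]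
    · have h : p α = 0 := le_antisymm (not_lt.1 hα) (hp0 α)
      simp [h]

end
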